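/- Let S be a finite set of r points in a complex projective space P^N (N ≥ 2) satisfying the Cayley–Bacharach condition CB(m) with respect to the linear system of degree-m hypersurfaces. If r ≤ (5/2)·m + 1, then S is contained in a curve C ⊂ P^N of degree at most 2; that is, S lies on a line, on a smooth plane conic, or on the union of two lines. -/

import Mathlib

open MvPolynomial

noncomputable section

/-- Points of the complex projective space whose homogeneous coordinates are
indexed by `ι` (so for `ι = Fin (N+1)` this is `ℙ^N`). -/
abbrev PPt (ι : Type) : Type := Projectivization ℂ (ι → ℂ)

/-- A polynomial vanishes at a projective point if it vanishes at every
representative vector of the point. -/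
def PVanish {ι : Type} (f : MvPolynomial ι ℂ) (x : PPt ι) : Prop :=
  ∀ (v : ι → ℂ) (hv : v ≠ 0), Projectivization.mk ℂ v hv = x → eval v f = 0

/-- The zero locus of a polynomial in projective space. -/
def ZeroSet {ι : Type} (f : MvPolynomial ι ℂ) : Set (PPt ι) :=
  {x | PVanish f x}

/-- Zariski-closed subsets of projective space: common zero loci of families of
homogeneous polynomials. -/
def IsZClosed {ι : Type} (Y : Set (PPt ι)) : Prop :=
  ∃ fs : Set (MvPolynomial ι ℂ),
    (∀ f ∈ fs, ∃ e, f.IsHomogeneous e) ∧ Y = {x | ∀ f ∈ fs, PVanish f x}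

/-- `U` contains a dense (Zariski-)open subset of `X`: there is a Zariski-closed
set `Y` not containing `X` with `X \ Y ⊆ U`.  Taking `X = Set.univ` this is the
notion of a set containing "the general point" of the ambient projective space. -/
def ContainsDenseOpenOf {ι : Type} (X U : Set (PPt ι)) : Prop :=
  ∃ Y : Set (PPt ι), IsZClosed Y ∧ ¬ X ⊆ Y ∧ X \ Y ⊆ U

/-- The set of projective points lying in (the projectivization of) a linear
subspace `W`. -/
def LinSet {ι : Type} (W : Submodule ℂ (ι → ℂ)) : Set (PPt ι) :=
  {x | x.submodule ≤ W}

/-- A line in projective space: the projectivization of a 2-dimensional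
linear subspace. -/
def IsLine {ι : Type} (L : Set (PPt ι)) : Prop :=
  ∃ W : Submodule ℂ (ι → ℂ), Module.finrank ℂ W = 2 ∧ L = LinSet W

/-- A smooth plane conic with supporting plane `P(W)`: the zero locus, inside the
projective plane `P(W)`, of a quadric which does not vanish identically on `W`
and whose restriction to `W` has no singular points. -/
def IsConicIn {ι : Type} [Fintype ι] (W : Submodule ℂ (ι → ℂ))
    (C : Set (PPt ι)) : Prop :=
  Module.finrank ℂ W = 3 ∧
  ∃ f : MvPolynomial ι ℂ, f.IsHomogeneous 2 ∧
    C = {x | x.submodule ≤ W ∧ PVanish f x} ∧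
    (∃ v ∈ W, eval v f ≠ 0) ∧
    (∀ v ∈ W, v ≠ 0 → eval v f = 0 →
      ∃ w ∈ W, (∑ i, eval v (pderiv i f) * w i) ≠ 0)

/-- A smooth plane conic in projective space. -/
def IsSmoothConic {ι : Type} [Fintype ι] (C : Set (PPt ι)) : Prop :=
  ∃ W, IsConicIn W C

/-- The Cayley–Bacharach condition `CB(m)`: every degree-`m` hypersurface
containing all points of `S` but one contains all of `S`. -/
def SatisfiesCB {ι : Type} (m : ℕ) (S : Finset (PPt ι)) : Prop :=
  ∀ f : MvPolynomial ι ℂ, f.IsHomogeneous m →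
    ∀ p ∈ S, (∀ q ∈ S, q ≠ p → PVanish f q) → PVanish f p

/-- A smooth projective hypersurface of degree `e`: the partial derivatives of
its (homogeneous) equation have no common nontrivial zero. -/
def IsSmoothHyp {ι : Type} [Fintype ι] (f : MvPolynomial ι ℂ) (e : ℕ) : Prop :=
  f.IsHomogeneous e ∧ f ≠ 0 ∧
    ∀ v : ι → ℂ, v ≠ 0 → ¬ (∀ i, eval v (pderiv i f) = 0)

/-- `{f = g = 0}` is a smooth complete intersection: at every common nontrivial
zero the two gradients are linearly independent. -/
def IsSmoothCI2 {ι : Type} [Fintype ι] (f g : MvPolynomial ι ℂ) : Prop :=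
  ∀ v : ι → ℂ, v ≠ 0 → eval v f = 0 → eval v g = 0 →
    ∀ a b : ℂ, (∀ i, a * eval v (pderiv i f) + b * eval v (pderiv i g) = 0) →
      a = 0 ∧ b = 0

/-- `{f = g = h = 0}` is a smooth complete intersection: at every common
nontrivial zero the three gradients are linearly independent. -/
def IsSmoothCI3 {ι : Type} [Fintype ι] (f g h : MvPolynomial ι ℂ) : Prop :=
  ∀ v : ι → ℂ, v ≠ 0 → eval v f = 0 → eval v g = 0 → eval v h = 0 →
    ∀ a b c : ℂ,
      (∀ i, a * eval v (pderiv i f) + b * eval v (pderiv i g)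
        + c * eval v (pderiv i h) = 0) →
      a = 0 ∧ b = 0 ∧ c = 0

/-- A rational map from (a subvariety of) the projective space with coordinates
`ι` to `ℙ^n`, given by an `(n+1)`-tuple of homogeneous polynomials of a common
degree `e`. -/
structure RatMapTo (ι : Type) (n : ℕ) where
  F : Fin (n + 1) → MvPolynomial ι ℂ
  e : ℕ
  homog : ∀ j, (F j).IsHomogeneous e

namespace RatMapTo

variable {ι : Type} {n : ℕ}

def evalVec (φ : RatMapTo ι n) (v : ι → ℂ) : Fin (n + 1) → ℂ :=
  fun j => eval v (φ.F j)

/-- `φ` is defined at `x` and sends `x` to `y`. -/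
def mapsTo (φ : RatMapTo ι n) (x : PPt ι) (y : PPt (Fin (n + 1))) : Prop :=
  ∀ (v : ι → ℂ) (hv : v ≠ 0), Projectivization.mk ℂ v hv = x →
    ∃ hw : φ.evalVec v ≠ 0, Projectivization.mk ℂ (φ.evalVec v) hw = y

/-- The fiber over `y` of the restriction of `φ` to `X`. -/
def fiber (φ : RatMapTo ι n) (X : Set (PPt ι)) (y : PPt (Fin (n + 1))) :
    Set (PPt ι) :=
  {x ∈ X | φ.mapsTo x y}

/-- The restriction of `φ` to `X` is a dominant rational map of degree `δ`:
the fiber over a general point of `ℙ^n` consists of exactly `δ` points. -/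
def DominantOfDegree (φ : RatMapTo ι n) (X : Set (PPt ι)) (δ : ℕ) : Prop :=
  0 < δ ∧
  ∃ V : Set (PPt (Fin (n + 1))), ContainsDenseOpenOf Set.univ V ∧
    ∀ y ∈ V, (φ.fiber X y).Finite ∧ (φ.fiber X y).ncard = δ

end RatMapTo

/-- The degree of irrationality of `X`: the minimal degree of a dominant
rational map `X ⇢ ℙ^n`. -/
def irr {ι : Type} (n : ℕ) (X : Set (PPt ι)) : ℕ :=
  sInf {δ : ℕ | ∃ φ : RatMapTo ι n, φ.DominantOfDegree X δ}

/-- `ψ` is the linear projection away from the linear subspace `P(W)`: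
it is given by linear forms whose common kernel is exactly `W`. -/
def IsLinearProjectionFrom {ι : Type} {n : ℕ} (ψ : RatMapTo ι n)
    (W : Submodule ℂ (ι → ℂ)) : Prop :=
  ψ.e = 1 ∧ ∀ v : ι → ℂ, ψ.evalVec v = 0 ↔ v ∈ W

/-- The rational maps `φ` and `ψ` on `X` are birationally equivalent: they
differ by composition with a birational automorphism `τ` of the target `ℙ^n`. -/
def BirEquivTo {ι : Type} {n : ℕ} (X : Set (PPt ι)) (φ ψ : RatMapTo ι n) : Prop :=
  ∃ τ : RatMapTo (Fin (n + 1)) n, τ.DominantOfDegree Set.univ 1 ∧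
    ∃ U : Set (PPt ι), ContainsDenseOpenOf X U ∧
      ∀ x ∈ U, ∃ y z, φ.mapsTo x y ∧ ψ.mapsTo x z ∧ τ.mapsTo z y

/-- `A` is contained in a proper Zariski-closed subset of the (projective) space
of degree-`d` forms: it is cut out by a polynomial in the coefficients which is
not identically zero on degree-`d` forms. -/
def CoeffPolyProperClosed {ι : Type} (d : ℕ) (A : Set (MvPolynomial ι ℂ)) : Prop :=
  ∃ (κ : ℕ) (mons : Fin κ → (ι →₀ ℕ)) (Q : MvPolynomial (Fin κ) ℂ),
    (∀ g ∈ A, eval (fun j => coeff (mons j) g) Q = 0) ∧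
    (∃ g : MvPolynomial ι ℂ, g.IsHomogeneous d ∧
      eval (fun j => coeff (mons j) g) Q ≠ 0)

end


theorem pow_eq_zero_iff_aux {a : ℂ} {n : ℕ} (h : a ^ n = 0) : a = 0 := by
  by_contra h0
  exact pow_ne_zero n h0 h

theorem eval_smul_hom {ι : Type} {f : MvPolynomial ι ℂ} {n : ℕ} (hf : f.IsHomogeneous n)
    (v : ι → ℂ) (a : ℂ) : eval (a • v) f = a ^ n * eval v f := by
  rw [eval_eq, eval_eq, Finset.mul_sum]
  refine Finset.sum_congr rfl fun d hd => ?_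
  have h1 : ∑ i ∈ d.support, d i = n := by
    have := hf (mem_support_iff.1 hd)
    rw [Finsupp.weight_apply] at this
    simpa [Finsupp.sum] using this
  simp only [Pi.smul_apply, smul_eq_mul, mul_pow, Finset.prod_mul_distrib]
  rw [Finset.prod_pow_eq_pow_sum, h1]
  ring

theorem pvanish_iff {ι : Type} {f : MvPolynomial ι ℂ} {n : ℕ} (hf : f.IsHomogeneous n)
    (x : PPt ι) : PVanish f x ↔ eval x.rep f = 0 := by
  constructor
  · intro h
    exact h x.rep x.rep_nonzero x.mk_rep
  · intro h v hv hx
    subst hx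
    obtain ⟨a, ha⟩ := Projectivization.exists_smul_eq_mk_rep ℂ v hv
    rw [← ha, Units.smul_def] at h
    have h2 : eval ((a : ℂ) • v) f = (a : ℂ) ^ n * eval v f := by
      exact eval_smul_hom hf v a
    rw [h2] at h
    rcases mul_eq_zero.1 h with h | h
    · exact absurd (pow_eq_zero_iff_aux h) a.ne_zero
    · exact h

theorem mem_linSet {ι : Type} {W : Submodule ℂ (ι → ℂ)} {x : PPt ι} :
    x ∈ LinSet W ↔ x.rep ∈ W := by
  unfold LinSet
  rw [Set.mem_ofPred_eq, Projectivization.submodule_eq, Submodule.span_singleton_le_iff_mem]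

/-- The linear form as a polynomial. -/
noncomputable def linPoly {ι : Type} [Fintype ι] [DecidableEq ι] (φ : (ι → ℂ) →ₗ[ℂ] ℂ) :
    MvPolynomial ι ℂ := ∑ i, C (φ (Pi.single i 1)) * X i

theorem linPoly_hom {ι : Type} [Fintype ι] [DecidableEq ι] (φ : (ι → ℂ) →ₗ[ℂ] ℂ) :
    (linPoly φ).IsHomogeneous 1 := by
  refine IsHomogeneous.sum _ _ _ fun i _ => ?_
  simpa using (isHomogeneous_C ι (φ (Pi.single i 1))).mul (isHomogeneous_X ℂ i)

theorem linPoly_eval {ι : Type} [Fintype ι] [DecidableEq ι] (φ : (ι → ℂ) →ₗ[ℂ] ℂ)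
    (v : ι → ℂ) : eval v (linPoly φ) = φ v := by
  conv_rhs => rw [LinearMap.pi_apply_eq_sum_univ φ v]
  simp only [linPoly, map_sum, map_mul, eval_C, eval_X, smul_eq_mul]
  refine Finset.sum_congr rfl fun i _ => ?_
  rw [mul_comm]
  congr 2
  ext j
  simp [Pi.single_apply, eq_comm]

theorem linPoly_pderiv {ι : Type} [Fintype ι] [DecidableEq ι] (φ : (ι → ℂ) →ₗ[ℂ] ℂ)
    (i : ι) : pderiv i (linPoly φ) = C (φ (Pi.single i 1)) := by
  simp [linPoly, pderiv_X, Pi.single_apply]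

/-- Choose `t` avoiding finitely many values. -/
theorem avoid_values {α : Type} (T : Finset α) (a b : α → ℂ) (hb : ∀ x ∈ T, a x ≠ 0 ∨ b x ≠ 0) :
    ∃ t : ℂ, ∀ x ∈ T, a x + t * b x ≠ 0 := by
  classical
  obtain ⟨t, ht⟩ := Infinite.exists_notMem_finset (T.image fun x => - a x / b x)
  refine ⟨t, fun x hx h => ht (Finset.mem_image.2 ⟨x, hx, ?_⟩)⟩
  by_cases hbx : b x = 0
  · rcases hb x hx with h1 | h1
    · simp [hbx] at h; exact absurd h h1
    · exact absurd hbx h1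
  · field_simp
    linear_combination -h

theorem avoid_points {ι : Type} (W : Submodule ℂ (ι → ℂ))
    (T : Finset (PPt ι)) (hT : ∀ x ∈ T, x.rep ∉ W) :
    ∃ φ : (ι → ℂ) →ₗ[ℂ] ℂ, (∀ w ∈ W, φ w = 0) ∧ ∀ x ∈ T, φ x.rep ≠ 0 := by
  classical
  induction T using Finset.induction_on with
  | empty => exact ⟨0, by simp, by simp⟩
  | insert x T hx ih =>
    obtain ⟨φ, h1, h2⟩ := ih fun y hy => hT y (Finset.mem_insert_of_mem hy)
    obtain ⟨ψ, h3, h4⟩ := Submodule.exists_le_ker_of_notMem (hT x (Finset.mem_insert_self _ _))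
    obtain ⟨t, ht⟩ := avoid_values (insert x T) (fun y => φ y.rep) (fun y => ψ y.rep) (by
      intro y hy
      rcases Finset.mem_insert.1 hy with rfl | hy
      · right; assumption
      · left; exact h2 y hy)
    refine ⟨φ + t • ψ, fun w hw => ?_, fun y hy => ?_⟩
    · have h5 : ψ w = 0 := by exact h4 hw
      simp [h1 w hw, h5]
    · simpa using ht y hy

theorem cb_remove {ι : Type} {m d : ℕ} {S : Finset (PPt ι)} (hCB : SatisfiesCB (m + d) S)
    {g : MvPolynomial ι ℂ} (hg : g.IsHomogeneous d) (T : Finset (PPt ι))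
    (hT : ∀ x, x ∈ T ↔ x ∈ S ∧ eval x.rep g ≠ 0) : SatisfiesCB m T := by
  intro f hf p hp hq
  have hfg := hf.mul hg
  have h := hCB (f * g) hfg p ((hT p).1 hp).1 (by
    intro q hqS hqp
    rw [pvanish_iff hfg, map_mul]
    by_cases hgq : eval q.rep g = 0
    · simp [hgq]
    · have := hq q ((hT q).2 ⟨hqS, hgq⟩) hqp
      rw [pvanish_iff hf] at this
      simp [this])
  rw [pvanish_iff hfg, map_mul] at h
  rw [pvanish_iff hf]
  exact (mul_eq_zero.1 h).resolve_right ((hT p).1 hp).2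

open Classical in
theorem cb_lin {ι : Type} [Fintype ι] {m : ℕ} {S : Finset (PPt ι)} (hCB : SatisfiesCB (m + 1) S)
    (W : Submodule ℂ (ι → ℂ)) : SatisfiesCB m (S.filter fun x => x ∉ LinSet W) := by
  obtain ⟨φ, h1, h2⟩ := avoid_points W (S.filter fun x => x ∉ LinSet W) (by
    intro x hx; rw [← mem_linSet]; exact (Finset.mem_filter.1 hx).2)
  refine cb_remove hCB (linPoly_hom φ) _ fun x => ?_
  rw [linPoly_eval]
  constructor
  · intro hx
    exact ⟨(Finset.mem_filter.1 hx).1, h2 x hx⟩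
  · rintro ⟨hx, hne⟩
    refine Finset.mem_filter.2 ⟨hx, fun hW => hne (h1 _ (mem_linSet.1 hW))⟩

theorem rep_mem_span_iff {ι : Type} {x y : PPt ι} :
    x.rep ∈ Submodule.span ℂ {y.rep} ↔ x = y := by
  constructor
  · intro h
    obtain ⟨a, ha⟩ := Submodule.mem_span_singleton.1 h
    rw [← x.mk_rep, ← y.mk_rep, Projectivization.mk_eq_mk_iff']
    exact ⟨a, ha⟩
  · rintro rfl
    exact Submodule.mem_span_singleton_self _

theorem cb_two_le {ι : Type} [Fintype ι] {m : ℕ} {S : Finset (PPt ι)} (hCB : SatisfiesCB m S)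
    (hS : S.Nonempty) : 2 ≤ S.card := by
  by_contra hlt
  have h1 : S.card = 1 := by have := hS.card_pos; omega
  obtain ⟨p, rfl⟩ := Finset.card_eq_one.1 h1
  classical
  obtain ⟨φ, -, h2⟩ := avoid_points (⊥ : Submodule ℂ (ι → ℂ)) {p} (by
    intro x _; simpa using x.rep_nonzero)
  have hh : (linPoly φ ^ m).IsHomogeneous m := by simpa using (linPoly_hom φ).pow m
  have := hCB _ hh p (by simp) (by
    intro q hq hqp; exact absurd (Finset.mem_singleton.1 hq) hqp)
  rw [pvanish_iff hh, map_pow, linPoly_eval] at this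
  exact h2 p (by simp) (pow_eq_zero_iff_aux this)

theorem cb_card {ι : Type} [Fintype ι] {m : ℕ} : ∀ {S : Finset (PPt ι)}, SatisfiesCB m S →
    S.Nonempty → m + 2 ≤ S.card := by
  classical
  induction m with
  | zero => intro S h hS; simpa using cb_two_le h hS
  | succ m ih =>
    intro S hCB hS
    have h2 := cb_two_le hCB hS
    obtain ⟨q, hq⟩ := hS
    have hc := cb_lin hCB (Submodule.span ℂ {q.rep})
    have he : (S.filter fun x => x ∉ LinSet (Submodule.span ℂ {q.rep})) = S.erase q := by
      ext x
      simp only [Finset.mem_filter, mem_linSet, rep_mem_span_iff, Finset.mem_erase]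
      tauto
    rw [he] at hc
    have hcard := Finset.card_erase_of_mem hq
    have := ih hc (Finset.card_pos.1 (by omega))
    omega

theorem exists_extend_finrank {ι : Type} [Fintype ι] (V : Submodule ℂ (ι → ℂ)) (k : ℕ)
    (h1 : Module.finrank ℂ V ≤ k) (h2 : k ≤ Fintype.card ι) :
    ∃ W : Submodule ℂ (ι → ℂ), V ≤ W ∧ Module.finrank ℂ W = k := by
  induction k, h1 using Nat.le_induction with
  | base => exact ⟨V, le_rfl, rfl⟩
  | succ k hk ih =>
    obtain ⟨W, hW, hk⟩ := ih (by omega)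
    have hne : W ≠ ⊤ := by
      rintro rfl
      rw [finrank_top, Module.finrank_fintype_fun_eq_card] at hk
      omega
    obtain ⟨v, -, hv⟩ := SetLike.exists_of_lt (lt_top_iff_ne_top.2 hne)
    exact ⟨W ⊔ Submodule.span ℂ {v}, hW.trans le_sup_left, by
      rw [Submodule.finrank_sup_span_singleton hv, hk]⟩

/-- The linear span of two projective points. -/
def pairSpan {ι : Type} (p q : PPt ι) : Submodule ℂ (ι → ℂ) :=
  Submodule.span ℂ {p.rep} ⊔ Submodule.span ℂ {q.rep}

theorem left_mem_pairSpan {ι : Type} (p q : PPt ι) : p.rep ∈ pairSpan p q :=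
  Submodule.mem_sup_left (Submodule.mem_span_singleton_self _)

theorem right_mem_pairSpan {ι : Type} (p q : PPt ι) : q.rep ∈ pairSpan p q :=
  Submodule.mem_sup_right (Submodule.mem_span_singleton_self _)

theorem finrank_pairSpan {ι : Type} [Fintype ι] {p q : PPt ι} (h : p ≠ q) :
    Module.finrank ℂ (pairSpan p q) = 2 := by
  unfold pairSpan
  rw [Submodule.finrank_sup_span_singleton, finrank_span_singleton p.rep_nonzero]
  rw [rep_mem_span_iff]
  exact h.symm

open Classical in
theorem card_filter_ge {α : Type} (S T : Finset α) (C : Set α) (hT : T ⊆ S)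
    (hC : ∀ x ∈ T, x ∈ C) : T.card + (S.filter fun x => x ∉ C).card ≤ S.card := by
  rw [← Finset.card_union_of_disjoint]
  · exact Finset.card_le_card (Finset.union_subset hT (Finset.filter_subset _ _))
  · rw [Finset.disjoint_left]
    intro x hx hx2
    exact (Finset.mem_filter.1 hx2).2 (hC x hx)

/-- Few points with `CB(m)` are collinear. -/
theorem cb_line {ι : Type} [Fintype ι] (hι : 2 ≤ Fintype.card ι) {m : ℕ} :
    ∀ {S : Finset (PPt ι)}, SatisfiesCB m S → S.card ≤ 2 * m + 1 →
    ∃ W : Submodule ℂ (ι → ℂ), Module.finrank ℂ W = 2 ∧ ∀ x ∈ S, x ∈ LinSet W := by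
  classical
  have h0 : ∃ W : Submodule ℂ (ι → ℂ), Module.finrank ℂ W = 2 := by
    obtain ⟨W, -, h⟩ := exists_extend_finrank (⊥ : Submodule ℂ (ι → ℂ)) 2 (by simp) hι
    exact ⟨W, h⟩
  have hemp : ∀ S : Finset (PPt ι), ¬ S.Nonempty →
      ∃ W : Submodule ℂ (ι → ℂ), Module.finrank ℂ W = 2 ∧ ∀ x ∈ S, x ∈ LinSet W := by
    intro S hS
    obtain ⟨W, hW⟩ := h0
    exact ⟨W, hW, fun x hx => absurd ⟨x, hx⟩ hS⟩
  induction m with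
  | zero =>
    intro S hCB hc
    apply hemp
    intro hS
    have := cb_card hCB hS
    omega
  | succ m ih =>
    intro S hCB hc
    by_cases hS : S.Nonempty
    swap
    · exact hemp S hS
    have h2 := cb_card hCB hS
    obtain ⟨p, hp, q, hq, hpq⟩ := Finset.one_lt_card.1 (show 1 < S.card by omega)
    have hW := finrank_pairSpan hpq
    have hT := cb_lin hCB (pairSpan p q)
    have hTc := card_filter_ge S {p, q} (LinSet (pairSpan p q)) (by
      intro x hx
      rcases Finset.mem_insert.1 hx with rfl | hx
      · exact hp
      · rw [Finset.mem_singleton.1 hx]; exact hq) (by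
      intro x hx
      rw [mem_linSet]
      rcases Finset.mem_insert.1 hx with rfl | hx
      · exact left_mem_pairSpan _ _
      · rw [Finset.mem_singleton.1 hx]; exact right_mem_pairSpan _ _)
    rw [Finset.card_pair hpq] at hTc
    obtain ⟨W', hW', hTW⟩ := ih hT (by omega)
    by_cases hTe : (S.filter fun x => x ∉ LinSet (pairSpan p q)).Nonempty
    swap
    · refine ⟨_, hW, fun x hx => ?_⟩
      by_contra hx2
      exact hTe ⟨x, Finset.mem_filter.2 ⟨hx, hx2⟩⟩
    have hT2 := cb_card hT hTe
    by_cases hTe' : (S.filter fun x => x ∉ LinSet W').Nonempty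
    swap
    · refine ⟨_, hW', fun x hx => ?_⟩
      by_contra hx2
      exact hTe' ⟨x, Finset.mem_filter.2 ⟨hx, hx2⟩⟩
    have hT3 := cb_card (cb_lin hCB W') hTe'
    have := card_filter_ge S _ (LinSet W') (Finset.filter_subset _ _) hTW
    omega

/-- Curves of degree at most two. -/
def IsCurve2 {ι : Type} [Fintype ι] (C : Set (PPt ι)) : Prop :=
  IsLine C ∨ IsSmoothConic C ∨ ∃ L₁ L₂ : Set (PPt ι), IsLine L₁ ∧ IsLine L₂ ∧ C = L₁ ∪ L₂

theorem filter_filter_aux {α : Type} (S : Finset α) (A B : Set α)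
    (i1 : DecidablePred fun x => x ∉ A) (i2 : DecidablePred fun x => x ∉ B)
    (i3 : DecidablePred fun x => x ∉ A ∪ B) :
    ((S.filter fun x => x ∉ A).filter fun x => x ∉ B) = S.filter fun x => x ∉ A ∪ B := by
  ext x
  simp [and_assoc]

open Classical in
theorem cb_conic {ι : Type} [Fintype ι] {m : ℕ} {S : Finset (PPt ι)}
    (hCB : SatisfiesCB (m + 2) S) {C : Set (PPt ι)} (hC : IsSmoothConic C) :
    SatisfiesCB m (S.filter fun x => x ∉ C) := by
  obtain ⟨W, -, f, hf, hCeq, -, -⟩ := hC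
  obtain ⟨φ, h1, h2⟩ := avoid_points W (S.filter fun x => x ∉ LinSet W) (by
    intro x hx; rw [← mem_linSet]; exact (Finset.mem_filter.1 hx).2)
  have hmem : ∀ x : PPt ι, x ∈ C ↔
      x.rep ∈ W ∧ eval x.rep f = 0 := by
    intro x
    rw [← mem_linSet, ← pvanish_iff hf, hCeq]
    rfl
  obtain ⟨t, ht⟩ := avoid_values
    (S.filter fun x => x ∉ C)
    (fun x => eval x.rep f) (fun x => φ x.rep * φ x.rep) (by
      intro x hx
      obtain ⟨hxS, hx⟩ := Finset.mem_filter.1 hx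
      rw [hmem] at hx
      by_cases hW : x.rep ∈ W
      · left
        exact fun h => hx ⟨hW, h⟩
      · right
        have := h2 x (Finset.mem_filter.2 ⟨hxS, by rwa [mem_linSet]⟩)
        exact mul_ne_zero this this)
  have hg : (f + MvPolynomial.C t * (linPoly φ * linPoly φ)).IsHomogeneous 2 := by
    refine hf.add ?_
    simpa using (isHomogeneous_C ι t).mul ((linPoly_hom φ).mul (linPoly_hom φ))
  refine cb_remove hCB hg _ fun x => ?_
  simp only [map_add, map_mul, eval_C, linPoly_eval]
  constructor
  · intro hx
    exact ⟨(Finset.mem_filter.1 hx).1, ht x hx⟩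
  · rintro ⟨hx, hne⟩
    refine Finset.mem_filter.2 ⟨hx, fun hW => hne ?_⟩
    rw [hmem] at hW
    rw [hW.2, h1 _ hW.1]
    ring

open Classical in
theorem cb_curve {ι : Type} [Fintype ι] {m : ℕ} {S : Finset (PPt ι)}
    (hCB : SatisfiesCB (m + 2) S) {C : Set (PPt ι)} (hC : IsCurve2 C) :
    SatisfiesCB m (S.filter fun x => x ∉ C) := by
  rcases hC with ⟨W, -, rfl⟩ | hC | ⟨_, _, ⟨W, -, rfl⟩, ⟨W', -, rfl⟩, rfl⟩
  · have := cb_lin (cb_lin hCB W) W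
    rw [Finset.filter_filter] at this
    simpa only [and_self] using this
  · exact cb_conic hCB hC
  · have := cb_lin (cb_lin hCB W) W'
    rwa [filter_filter_aux] at this

theorem conic_or_lines {ι : Type} [Fintype ι] (W : Submodule ℂ (ι → ℂ))
    (hW : Module.finrank ℂ W = 3) (L₁ L₂ L₃ L₄ : (ι → ℂ) →ₗ[ℂ] ℂ) (a b : ℂ)
    (u : ι → ℂ) (hu : u ∈ W) (hu0 : a * (L₁ u * L₂ u) + b * (L₃ u * L₄ u) ≠ 0)
    (S : Finset (PPt ι)) (hS : ∀ x ∈ S, x.rep ∈ W)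
    (hS0 : ∀ x ∈ S, a * (L₁ x.rep * L₂ x.rep) + b * (L₃ x.rep * L₄ x.rep) = 0) :
    ∃ C, IsCurve2 C ∧ ∀ x ∈ S, x ∈ C := by
  classical
  have hι : 2 ≤ Fintype.card ι := by
    have := Submodule.finrank_le W
    rw [Module.finrank_fintype_fun_eq_card] at this
    omega
  set f : MvPolynomial ι ℂ := MvPolynomial.C a * (linPoly L₁ * linPoly L₂) +
    MvPolynomial.C b * (linPoly L₃ * linPoly L₄) with hfdef
  have hf : f.IsHomogeneous 2 := by
    refine IsHomogeneous.add ?_ ?_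
    · simpa using (isHomogeneous_C ι a).mul ((linPoly_hom L₁).mul (linPoly_hom L₂))
    · simpa using (isHomogeneous_C ι b).mul ((linPoly_hom L₃).mul (linPoly_hom L₄))
  have hfe : ∀ v, eval v f = a * (L₁ v * L₂ v) + b * (L₃ v * L₄ v) := by
    intro v
    simp [hfdef, linPoly_eval]
  have hsum : ∀ (L : (ι → ℂ) →ₗ[ℂ] ℂ) (w : ι → ℂ), ∑ i, L (Pi.single i 1) * w i = L w := by
    intro L w
    rw [← linPoly_eval L w]
    simp [linPoly]
  have hgrad : ∀ v w : ι → ℂ, (∑ i, eval v (pderiv i f) * w i) =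
      a * (L₁ v * L₂ w + L₁ w * L₂ v) + b * (L₃ v * L₄ w + L₃ w * L₄ v) := by
    intro v w
    rw [← hsum L₁ w, ← hsum L₂ w, ← hsum L₃ w, ← hsum L₄ w]
    simp only [Finset.mul_sum, Finset.sum_mul, ← Finset.sum_add_distrib]
    refine Finset.sum_congr rfl fun i _ => ?_
    simp [hfdef, linPoly_eval, linPoly_pderiv, Derivation.leibniz]
    ring
  by_cases hsm : ∀ v ∈ W, v ≠ 0 → eval v f = 0 →
      ∃ w ∈ W, (∑ i, eval v (pderiv i f) * w i) ≠ 0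
  · refine ⟨_, Or.inr (Or.inl ⟨W, hW, f, hf, rfl, ⟨u, hu, by rwa [hfe]⟩, hsm⟩), fun x hx => ?_⟩
    refine ⟨mem_linSet.2 (hS x hx), ?_⟩
    rw [pvanish_iff hf, hfe]
    exact hS0 x hx
  push Not at hsm
  obtain ⟨v, hvW, hv0, hvf, hvB⟩ := hsm
  simp only [hgrad] at hvB
  rw [hfe] at hvf
  have hr1 := finrank_span_singleton (K := ℂ) hv0
  by_cases h1 : ∃ p ∈ S, p.rep ∉ Submodule.span ℂ {v}
  swap
  · push Not at h1
    obtain ⟨V, hV, hV2⟩ := exists_extend_finrank (Submodule.span ℂ {v}) 2 (by omega) hι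
    exact ⟨LinSet V, Or.inl ⟨V, hV2, rfl⟩, fun x hx => mem_linSet.2 (hV (h1 x hx))⟩
  obtain ⟨p, hp, hpv⟩ := h1
  have hr2 := Submodule.finrank_sup_span_singleton hpv
  by_cases h2 : ∃ q ∈ S, q.rep ∉ Submodule.span ℂ {v} ⊔ Submodule.span ℂ {p.rep}
  swap
  · push Not at h2
    exact ⟨LinSet _, Or.inl ⟨_, by omega, rfl⟩, fun x hx => mem_linSet.2 (h2 x hx)⟩
  obtain ⟨q, hq, hqv⟩ := h2
  have hr3 := Submodule.finrank_sup_span_singleton hqv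
  have hqv' : q.rep ∉ Submodule.span ℂ {v} := fun h => hqv (Submodule.mem_sup_left h)
  have hr4 := Submodule.finrank_sup_span_singleton hqv'
  have hWeq : Submodule.span ℂ {v} ⊔ Submodule.span ℂ {p.rep} ⊔ Submodule.span ℂ {q.rep} = W := by
    apply Submodule.eq_of_le_of_finrank_eq
    · simp only [sup_le_iff, Submodule.span_singleton_le_iff_mem]
      exact ⟨⟨hvW, hS p hp⟩, hS q hq⟩
    · omega
  have hdec : ∀ w ∈ W, ∃ x y z : ℂ, w = x • v + y • p.rep + z • q.rep := by
    intro w hw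
    rw [← hWeq] at hw
    obtain ⟨w1, hw1, w2, hw2, rfl⟩ := Submodule.mem_sup.1 hw
    obtain ⟨w3, hw3, w4, hw4, rfl⟩ := Submodule.mem_sup.1 hw1
    obtain ⟨x, rfl⟩ := Submodule.mem_span_singleton.1 hw3
    obtain ⟨y, rfl⟩ := Submodule.mem_span_singleton.1 hw4
    obtain ⟨z, rfl⟩ := Submodule.mem_span_singleton.1 hw2
    exact ⟨x, y, z, rfl⟩
  have hvp := hvB _ (hS p hp)
  have hvq := hvB _ (hS q hq)
  have hp0 := hS0 p hp
  have hq0 := hS0 q hq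
  have hQ : ∀ x y z : ℂ, ∀ w, w = x • v + y • p.rep + z • q.rep →
      a * (L₁ w * L₂ w) + b * (L₃ w * L₄ w) = y * z * (a * (L₁ p.rep * L₂ q.rep + L₁ q.rep * L₂ p.rep)
        + b * (L₃ p.rep * L₄ q.rep + L₃ q.rep * L₄ p.rep)) := by
    rintro x y z w rfl
    simp only [map_add, map_smul, smul_eq_mul]
    linear_combination x ^ 2 * hvf + y ^ 2 * hp0 + z ^ 2 * hq0 + x * y * hvp + x * z * hvq
  have hB : a * (L₁ p.rep * L₂ q.rep + L₁ q.rep * L₂ p.rep)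
        + b * (L₃ p.rep * L₄ q.rep + L₃ q.rep * L₄ p.rep) ≠ 0 := by
    intro h
    obtain ⟨x, y, z, hxyz⟩ := hdec u hu
    apply hu0
    rw [hQ x y z u hxyz, h, mul_zero]
  refine ⟨LinSet _ ∪ LinSet _, Or.inr (Or.inr ⟨_, _, ⟨_, hr2.trans (by omega), rfl⟩,
    ⟨_, hr4.trans (by omega), rfl⟩, rfl⟩), fun s hs => ?_⟩
  obtain ⟨x, y, z, hxyz⟩ := hdec s.rep (hS s hs)
  have h0 := hS0 s hs
  rw [hQ x y z _ hxyz] at h0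
  rcases mul_eq_zero.1 ((mul_eq_zero.1 h0).resolve_right hB) with h | h
  · right
    rw [mem_linSet, hxyz, h, zero_smul, add_zero]
    exact Submodule.add_mem_sup (Submodule.smul_mem _ _ (Submodule.mem_span_singleton_self _))
      (Submodule.smul_mem _ _ (Submodule.mem_span_singleton_self _))
  · left
    rw [mem_linSet, hxyz, h, zero_smul, add_zero]
    exact Submodule.add_mem_sup (Submodule.smul_mem _ _ (Submodule.mem_span_singleton_self _))
      (Submodule.smul_mem _ _ (Submodule.mem_span_singleton_self _))

/-- No line contains three points of `S`. -/
def NoThree {ι : Type} (S : Finset (PPt ι)) : Prop :=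
  ∀ U : Finset (PPt ι), U ⊆ S → ∀ W : Submodule ℂ (ι → ℂ), Module.finrank ℂ W = 2 →
    (∀ x ∈ U, x ∈ LinSet W) → U.card ≤ 2

theorem noThree_cb {ι : Type} [Fintype ι] (hι : 2 ≤ Fintype.card ι) {S U : Finset (PPt ι)}
    (hS : NoThree S) (hU : U ⊆ S) {k : ℕ} (hCB : SatisfiesCB k U) (hne : U.Nonempty) :
    2 * k + 2 ≤ U.card := by
  by_contra hlt
  obtain ⟨W, hW, hUW⟩ := cb_line hι hCB (by omega)
  have h1 := hS U hU W hW hUW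
  have h2 := cb_card hCB hne
  omega

theorem noThree_curve {ι : Type} [Fintype ι] (hι : 2 ≤ Fintype.card ι) {S U : Finset (PPt ι)}
    (hS : NoThree S) (hU : U ⊆ S) {k : ℕ} (hCB : SatisfiesCB (k + 2) S) {C : Set (PPt ι)}
    (hC : IsCurve2 C) (hUC : ∀ x ∈ U, x ∈ C) (_h5 : 5 ≤ U.card)
    (hc : S.card < U.card + (2 * k + 2)) : ∀ x ∈ S, x ∈ C := by
  classical
  by_contra hne
  push Not at hne
  obtain ⟨x, hx, hxC⟩ := hne
  have h1 := noThree_cb hι hS (Finset.filter_subset _ _) (cb_curve hCB hC)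
    ⟨x, Finset.mem_filter.2 ⟨hx, hxC⟩⟩
  have h2 := card_filter_ge S U C hU hUC
  omega

theorem noThree_notMem {ι : Type} [Fintype ι] {S : Finset (PPt ι)}
    (hS : NoThree S) {p q s : PPt ι} (hp : p ∈ S) (hq : q ∈ S) (hs : s ∈ S)
    (hpq : p ≠ q) (hps : p ≠ s) (hqs : q ≠ s) : s.rep ∉ pairSpan p q := by
  classical
  intro h
  have h3 : ({p, q, s} : Finset (PPt ι)).card = 3 := Finset.card_eq_three.2
    ⟨p, q, s, hpq, hps, hqs, rfl⟩
  have := hS {p, q, s} (by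
    intro x hx
    simp only [Finset.mem_insert, Finset.mem_singleton] at hx
    rcases hx with rfl | rfl | rfl <;> assumption) _ (finrank_pairSpan hpq) (by
    intro x hx
    rw [mem_linSet]
    simp only [Finset.mem_insert, Finset.mem_singleton] at hx
    rcases hx with rfl | rfl | rfl
    · exact left_mem_pairSpan _ _
    · exact right_mem_pairSpan _ _
    · exact h)
  omega

theorem noThree_form {ι : Type} [Fintype ι] {S : Finset (PPt ι)}
    (hS : NoThree S) {p q : PPt ι} (hp : p ∈ S) (hq : q ∈ S) (hpq : p ≠ q) :
    ∃ L : (ι → ℂ) →ₗ[ℂ] ℂ, L p.rep = 0 ∧ L q.rep = 0 ∧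
      ∀ s ∈ S, s ≠ p → s ≠ q → L s.rep ≠ 0 := by
  classical
  obtain ⟨φ, h1, h2⟩ := avoid_points (pairSpan p q) ((S.erase p).erase q) (by
    intro s hs
    simp only [Finset.mem_erase] at hs
    exact noThree_notMem hS hp hq hs.2.2 hpq (Ne.symm hs.2.1) (Ne.symm hs.1))
  refine ⟨φ, h1 _ (left_mem_pairSpan _ _), h1 _ (right_mem_pairSpan _ _), fun s hs h3 h4 => ?_⟩
  exact h2 s (by simp [hs, h3, h4])

theorem main_aux {ι : Type} [Fintype ι] (hι : 2 ≤ Fintype.card ι) (m : ℕ) :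
    ∀ S : Finset (PPt ι), SatisfiesCB m S → 2 * S.card ≤ 5 * m + 2 →
    ∃ C, IsCurve2 C ∧ ∀ x ∈ S, x ∈ C := by
  classical
  induction m using Nat.strong_induction_on with
  | _ m ih =>
  intro S hCB hr
  by_cases hsmall : S.card ≤ 2 * m + 1
  · obtain ⟨W, hW, hSW⟩ := cb_line hι hCB hsmall
    exact ⟨_, Or.inl ⟨W, hW, rfl⟩, hSW⟩
  obtain ⟨k, rfl⟩ : ∃ k, m = k + 2 := ⟨m - 2, by omega⟩
  by_cases hS : NoThree S
  swap
  · -- three collinear points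
    unfold NoThree at hS
    push Not at hS
    obtain ⟨U, hU, W, hW, hUW, hU3⟩ := hS
    have hT : SatisfiesCB (k + 1) (S.filter fun x => x ∉ LinSet W) := cb_lin hCB W
    have hTc := card_filter_ge S U (LinSet W) hU hUW
    obtain ⟨C, hC, hTC⟩ := ih (k + 1) (by omega) _ hT (by omega)
    by_cases hne : (S.filter fun x => x ∉ C).Nonempty
    swap
    · refine ⟨C, hC, fun x hx => ?_⟩
      by_contra hxC
      exact hne ⟨x, Finset.mem_filter.2 ⟨hx, hxC⟩⟩
    have h1 := cb_card (cb_curve hCB hC) hne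
    have h2 := card_filter_ge S (S.filter fun x => x ∉ C) (LinSet W) (Finset.filter_subset _ _) (by
      intro x hx
      obtain ⟨hxS, hxC⟩ := Finset.mem_filter.1 hx
      by_contra hxW
      exact hxC (hTC x (Finset.mem_filter.2 ⟨hxS, hxW⟩)))
    obtain ⟨W', hW', hTW'⟩ := cb_line hι hT (by omega)
    refine ⟨LinSet W ∪ LinSet W', Or.inr (Or.inr ⟨_, _, ⟨W, hW, rfl⟩, ⟨W', hW', rfl⟩, rfl⟩),
      fun x hx => ?_⟩
    by_cases hxW : x ∈ LinSet W
    · exact Or.inl hxW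
    · exact Or.inr (hTW' x (Finset.mem_filter.2 ⟨hx, hxW⟩))
  -- five points
  obtain ⟨F, hFS, hF⟩ := Finset.exists_subset_card_eq (show 5 ≤ S.card by omega)
  obtain ⟨p₁, p₂, p₃, p₄, p₅, h12, h13, h14, h15, h23, h24, h25, h34, h35, h45, hFe⟩ :
      ∃ p₁ p₂ p₃ p₄ p₅ : PPt ι, p₁ ≠ p₂ ∧ p₁ ≠ p₃ ∧ p₁ ≠ p₄ ∧ p₁ ≠ p₅ ∧ p₂ ≠ p₃ ∧ p₂ ≠ p₄ ∧
        p₂ ≠ p₅ ∧ p₃ ≠ p₄ ∧ p₃ ≠ p₅ ∧ p₄ ≠ p₅ ∧ F = {p₁, p₂, p₃, p₄, p₅} := by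
    obtain ⟨a, G, haG, rfl, hG⟩ := Finset.card_eq_succ.1 hF
    obtain ⟨b, H, hbH, rfl, hH⟩ := Finset.card_eq_succ.1 hG
    obtain ⟨c, d, e, h1, h2, h3, rfl⟩ := Finset.card_eq_three.1 hH
    simp only [Finset.mem_insert, Finset.mem_singleton, not_or] at haG hbH
    exact ⟨a, b, c, d, e, haG.1, haG.2.1, haG.2.2.1, haG.2.2.2, hbH.1, hbH.2.1, hbH.2.2,
      h1, h2, h3, rfl⟩
  subst hFe
  have m1 : p₁ ∈ S := hFS (by simp)
  have m2 : p₂ ∈ S := hFS (by simp)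
  have m3 : p₃ ∈ S := hFS (by simp)
  have m4 : p₄ ∈ S := hFS (by simp)
  have m5 : p₅ ∈ S := hFS (by simp)
  have h3W := Submodule.finrank_sup_span_singleton (noThree_notMem hS m1 m2 m3 h12 h13 h23)
  rw [finrank_pairSpan h12] at h3W
  set W := pairSpan p₁ p₂ ⊔ Submodule.span ℂ {p₃.rep} with hWdef
  have w1 : p₁.rep ∈ W := Submodule.mem_sup_left (left_mem_pairSpan _ _)
  have w2 : p₂.rep ∈ W := Submodule.mem_sup_left (right_mem_pairSpan _ _)
  have w3 : p₃.rep ∈ W := Submodule.mem_sup_right (Submodule.mem_span_singleton_self _)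
  by_cases hpl : ∀ x ∈ S, x.rep ∈ W
  swap
  · -- not planar
    push Not at hpl
    obtain ⟨x, hx, hxW⟩ := hpl
    have hT : SatisfiesCB (k + 1) (S.filter fun x => x ∉ LinSet W) := cb_lin hCB W
    have hTn := noThree_cb hι hS (Finset.filter_subset _ _) hT
      ⟨x, Finset.mem_filter.2 ⟨hx, by rwa [mem_linSet]⟩⟩
    have hTc := card_filter_ge S {p₁, p₂, p₃} (LinSet W) (by
      intro x hx
      simp only [Finset.mem_insert, Finset.mem_singleton] at hx
      rcases hx with rfl | rfl | rfl <;> assumption) (by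
      intro x hx
      rw [mem_linSet]
      simp only [Finset.mem_insert, Finset.mem_singleton] at hx
      rcases hx with rfl | rfl | rfl <;> assumption)
    rw [Finset.card_eq_three.2 ⟨p₁, p₂, p₃, h12, h13, h23, rfl⟩] at hTc
    obtain ⟨C, hC, hTC⟩ := ih (k + 1) (by omega) _ hT (by omega)
    exact ⟨C, hC, noThree_curve hι hS (Finset.filter_subset _ _) hCB hC hTC (by omega) (by omega)⟩
  -- planar
  obtain ⟨L₁, a1, a2, a⟩ := noThree_form hS m1 m2 h12
  obtain ⟨L₂, b3, b4, b⟩ := noThree_form hS m3 m4 h34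
  obtain ⟨L₃, c1, c3, c⟩ := noThree_form hS m1 m3 h13
  obtain ⟨L₄, d2, d4, d⟩ := noThree_form hS m2 m4 h24
  set α := L₃ p₅.rep * L₄ p₅.rep with hα
  set β := - (L₁ p₅.rep * L₂ p₅.rep) with hβ
  have hβ0 : β ≠ 0 := neg_ne_zero.2
    (mul_ne_zero (a _ m5 h15.symm h25.symm) (b _ m5 h35.symm h45.symm))
  set f : MvPolynomial ι ℂ := MvPolynomial.C α * (linPoly L₁ * linPoly L₂) +
    MvPolynomial.C β * (linPoly L₃ * linPoly L₄) with hfdef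
  have hf : f.IsHomogeneous 2 := by
    refine IsHomogeneous.add ?_ ?_
    · simpa using (isHomogeneous_C ι α).mul ((linPoly_hom L₁).mul (linPoly_hom L₂))
    · simpa using (isHomogeneous_C ι β).mul ((linPoly_hom L₃).mul (linPoly_hom L₄))
  have hfe : ∀ v, eval v f = α * (L₁ v * L₂ v) + β * (L₃ v * L₄ v) := by
    intro v
    simp [hfdef, linPoly_eval]
  by_cases hall : ∀ x ∈ S, eval x.rep f = 0
  · refine conic_or_lines W h3W L₁ L₂ L₃ L₄ α β (p₁.rep + p₂.rep) (W.add_mem w1 w2) ?_ S hpl ?_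
    · simp only [map_add, a1, a2, c1, d2, zero_add, add_zero, zero_mul, mul_zero]
      exact mul_ne_zero hβ0 (mul_ne_zero (c _ m2 h12.symm h23) (d _ m1 h12 h14))
    · intro x hx
      rw [← hfe]
      exact hall x hx
  push Not at hall
  obtain ⟨x, hx, hxf⟩ := hall
  have hT : SatisfiesCB k (S.filter fun x => x ∉ {x : PPt ι | eval x.rep f = 0}) := by
    refine cb_remove hCB hf _ fun x => ?_
    rw [Finset.mem_filter]
    rfl
  have hTn := noThree_cb hι hS (Finset.filter_subset _ _) hT
    ⟨x, Finset.mem_filter.2 ⟨hx, hxf⟩⟩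
  have hTc := card_filter_ge S _ {x : PPt ι | eval x.rep f = 0} hFS (by
    intro x hx
    show eval x.rep f = 0
    rw [hfe]
    simp only [Finset.mem_insert, Finset.mem_singleton] at hx
    rcases hx with rfl | rfl | rfl | rfl | rfl
    · rw [a1, c1]; ring
    · rw [a2, d2]; ring
    · rw [b3, c3]; ring
    · rw [b4, d4]; ring
    · rw [hα, hβ]; ring)
  rw [hF] at hTc
  obtain ⟨C, hC, hTC⟩ := ih k (by omega) _ hT (by omega)
  exact ⟨C, hC, noThree_curve hι hS (Finset.filter_subset _ _) hCB hC hTC (by omega) (by omega)⟩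

/-- A set of `r` points in `ℙ^N` (`N ≥ 2`) satisfying the
Cayley–Bacharach condition `CB(m)` with `r ≤ (5/2)·m + 1` lies on a curve of
degree at most 2: a line, a smooth plane conic, or a union of two lines. -/
theorem cayleyBacharach_points_on_degree_two_curve
    (N m : ℕ) (hN : 2 ≤ N) (S : Finset (PPt (Fin (N + 1))))
    (hCB : SatisfiesCB m S)
    (hr : 2 * S.card ≤ 5 * m + 2) :
    (∃ L : Set (PPt (Fin (N + 1))), IsLine L ∧ ↑S ⊆ L) ∨
    (∃ C : Set (PPt (Fin (N + 1))), IsSmoothConic C ∧ ↑S ⊆ C) ∨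
    (∃ L₁ L₂ : Set (PPt (Fin (N + 1))), IsLine L₁ ∧ IsLine L₂ ∧ ↑S ⊆ L₁ ∪ L₂) := by
  obtain ⟨C, hC, hSC⟩ := main_aux (by simp; omega) m S hCB hr
  rcases hC with hC | hC | ⟨L₁, L₂, h1, h2, rfl⟩
  · exact Or.inl ⟨C, hC, hSC⟩
  · exact Or.inr (Or.inl ⟨C, hC, hSC⟩)
  · exact Or.inr (Or.inr ⟨L₁, L₂, h1, h2, hSC⟩)
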